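/- Let g be a metric on S^n conformal to the round metric g₀, with Vol_g(S^n) = 1 and renormalized so that ∫ X_t dv_g = 0 for all t ∈ S^n. If the measure dv_g is multiple, then λ₂(S^n,g) ≤ n(2σ_n)^{2/n}. -/

import Mathlib

open MeasureTheory Metric Real Filter Set
open scoped RealInnerProductSpace ENNReal NNReal Topology Classical

noncomputable section

/-- Ambient Euclidean space `ℝ^{n+1}`. -/
abbrev Eu (n : ℕ) : Type := EuclideanSpace ℝ (Fin (n + 1))

/-- The unit sphere `S^n ⊆ ℝ^{n+1}` as a subset of the ambient space. -/
def sphSet (n : ℕ) : Set (Eu n) := Metric.sphere (0 : Eu n) 1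

/-- The canonical (round) volume measure of `S^n`, viewed as a measure on the
ambient space `ℝ^{n+1}` supported on the unit sphere. -/
def sphMeasure (n : ℕ) : Measure (Eu n) :=
  Measure.map Subtype.val ((volume : Measure (Eu n)).toSphere)

/-- `σ_n`, the volume of the round unit `n`-sphere. -/
def sigmaVol (n : ℕ) : ℝ := (sphMeasure n Set.univ).toReal

/-- The constant `K_n`. -/
def Kconst (n : ℕ) : ℝ :=
  ((n + 1 : ℝ) / n) *
    ((Real.Gamma n * Real.Gamma ((n + 1) / 2)) /
      (Real.Gamma (n + 1 / 2) * Real.Gamma (n / 2))) ^ ((2 : ℝ) / n)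

/-- The linear coordinate function `X_s(x) = s · x`. -/
def Xfun {n : ℕ} (s x : Eu n) : ℝ := ⟪s, x⟫

/-- The tangential gradient on the sphere of (the restriction of) an ambient function:
`∇_{S^n} f (x) = ∇f(x) - ⟨∇f(x), x⟩ x`. -/
def gradS {n : ℕ} (f : Eu n → ℝ) (x : Eu n) : Eu n :=
  gradient f x - ⟪gradient f x, x⟫ • x

/-- A conformal factor `w` represents the metric `g = w² g₀` on `S^n`; it is admissible if it
is smooth and positive on the sphere. -/
def IsConformalFactor (n : ℕ) (w : Eu n → ℝ) : Prop :=
  ContDiff ℝ (⊤ : ℕ∞) w ∧ ∀ x ∈ sphSet n, 0 < w x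

/-- The Riemannian measure `dv_g` of the conformal metric `g = w² g₀`, i.e. `w^n dv_{g₀}`. -/
def confMeasure (n : ℕ) (w : Eu n → ℝ) : Measure (Eu n) :=
  (sphMeasure n).withDensity fun x => ENNReal.ofReal (w x ^ n)

/-- The volume of `(S^n, g)`, `g = w² g₀`. -/
def confVol (n : ℕ) (w : Eu n → ℝ) : ℝ := (confMeasure n w Set.univ).toReal

/-- The Dirichlet energy `∫ |∇_g u|²_g dv_g` of the restriction to `S^n` of `V`,
for `g = w² g₀`: it equals `∫ w^{n-2} |∇_{g₀} V|²_{g₀} dv_{g₀}`. -/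
def dirichlet (n : ℕ) (w : Eu n → ℝ) (V : Eu n → ℝ) : ℝ :=
  ∫ x, w x ^ (n - 2) * ‖gradS V x‖ ^ 2 ∂(sphMeasure n)

/-- `∫ u² dv_g`. -/
def l2sq (n : ℕ) (w : Eu n → ℝ) (V : Eu n → ℝ) : ℝ :=
  ∫ x, (V x) ^ 2 ∂(confMeasure n w)

/-- Mean value zero w.r.t. `dv_g`. -/
def MeanZero (n : ℕ) (w : Eu n → ℝ) (V : Eu n → ℝ) : Prop :=
  ∫ x, V x ∂(confMeasure n w) = 0

/-- The second nonzero eigenvalue `λ₂(S^n, g)` of the Laplace–Beltrami operator of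
`g = w² g₀`, defined via the Courant–Fischer min-max characterization over two-dimensional
spaces of mean-zero test functions (restrictions of smooth ambient functions). -/
def lambda2 (n : ℕ) (w : Eu n → ℝ) : ℝ :=
  sInf { Λ : ℝ | ∃ V W : Eu n → ℝ, ContDiff ℝ (⊤ : ℕ∞) V ∧ ContDiff ℝ (⊤ : ℕ∞) W ∧
    MeanZero n w V ∧ MeanZero n w W ∧
    (∀ a b : ℝ, (∀ x ∈ sphSet n, a * V x + b * W x = 0) → a = 0 ∧ b = 0) ∧
    Λ = sSup { q : ℝ | ∃ a b : ℝ, ¬(a = 0 ∧ b = 0) ∧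
      q = dirichlet n w (fun x => a * V x + b * W x) /
          l2sq n w (fun x => a * V x + b * W x) } }

/-- The conformal transformation `d_ξ` of the closed unit ball. -/
def dMap {n : ℕ} (ξ : Eu n) (x : Eu n) : Eu n :=
  (1 + 2 * ⟪ξ, x⟫ + ‖x‖ ^ 2 * ‖ξ‖ ^ 2)⁻¹ •
    ((1 - ‖ξ‖ ^ 2) • x + (1 + 2 * ⟪ξ, x⟫ + ‖x‖ ^ 2) • ξ)

/-- The reflection `R_p(x) = x - 2(p·x)p`. -/
def Refl {n : ℕ} (p x : Eu n) : Eu n := x - (2 * ⟪p, x⟫) • p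

/-- The spherical cap `a_{r,p} = d_{rp}(a_{0,p})`. -/
def cap (n : ℕ) (r : ℝ) (p : Eu n) : Set (Eu n) :=
  dMap (r • p) '' {x ∈ sphSet n | 0 < ⟪p, x⟫}

/-- The conformal reflection `τ_{a_{r,p}} = d_{rp} ∘ R_p ∘ d_{-rp}`. -/
def tauMap {n : ℕ} (r : ℝ) (p : Eu n) : Eu n → Eu n :=
  dMap (r • p) ∘ Refl p ∘ dMap (-(r • p))

/-- The measure `μ_{a_{r,p}}`, equal to `dv_g + (τ_a)^* dv_g` on `a` and `0` on `a^*`. -/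
def capMeasure (n : ℕ) (w : Eu n → ℝ) (r : ℝ) (p : Eu n) : Measure (Eu n) :=
  (confMeasure n w + Measure.map (tauMap r p) (confMeasure n w)).restrict (cap n r p)

/-- `d_ξ` renormalizes the finite measure `μ`: `∫ X_s ∘ d_ξ dμ = 0` for all `s ∈ S^n`. -/
def Renormalizes {n : ℕ} (ξ : Eu n) (μ : Measure (Eu n)) : Prop :=
  ∀ s ∈ sphSet n, ∫ x, Xfun s (dMap ξ x) ∂μ = 0

/-- The quadratic form `Q(s) = ∫ X_s² dν` of a measure `ν`. -/
def Qform {n : ℕ} (ν : Measure (Eu n)) (s : Eu n) : ℝ := ∫ x, (⟪s, x⟫ : ℝ) ^ 2 ∂ν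

/-- The maximal eigenvalue of the quadratic form `Q`. -/
def maxEig (n : ℕ) (ν : Measure (Eu n)) : ℝ :=
  sSup { q : ℝ | ∃ s : Eu n, ‖s‖ = 1 ∧ q = Qform ν s }

/-- `ν` is simple with (unit) maximal direction `s₀`: the eigenspace of the maximal
eigenvalue of `Q` is the line spanned by `s₀`. -/
def IsMaxDir {n : ℕ} (ν : Measure (Eu n)) (s₀ : Eu n) : Prop :=
  ‖s₀‖ = 1 ∧ ∀ s : Eu n, Qform ν s = maxEig n ν * ‖s‖ ^ 2 ↔ ∃ c : ℝ, s = c • s₀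

/-- `ν` is multiple: the eigenspace of the maximal eigenvalue of `Q` has dimension ≥ 2. -/
def IsMultiple {n : ℕ} (ν : Measure (Eu n)) : Prop :=
  ∃ s t : Eu n, Qform ν s = maxEig n ν * ‖s‖ ^ 2 ∧ Qform ν t = maxEig n ν * ‖t‖ ^ 2 ∧
    LinearIndependent ℝ ![s, t]

/-- The test function `u_a^s` (for `a = a_{r,p}` with renormalization point `ξ`):
`X_s ∘ d_ξ` on `a` and `X_s ∘ d_ξ ∘ τ_a` on `a^*`. -/
def testFun (n : ℕ) (ξ : Eu n) (r : ℝ) (p : Eu n) (s : Eu n) (x : Eu n) : ℝ :=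
  if 0 < ⟪p, dMap (-(r • p)) x⟫ then Xfun s (dMap ξ x) else Xfun s (dMap ξ (tauMap r p x))

/-- The first coordinate vector `e₁ ∈ ℝ^{n+1}`. -/
def e1 (n : ℕ) : Eu n := EuclideanSpace.single 0 1

/-- A continuous function is integrable with respect to the round measure of the sphere. -/
theorem integrable_sphMeasure (n : ℕ) {f : Eu n → ℝ} (hf : Continuous f) :
    Integrable f (sphMeasure n) := by
  have hemb : MeasurableEmbedding (Subtype.val : Metric.sphere (0 : Eu n) 1 → Eu n) :=
    MeasurableEmbedding.subtype_coe Metric.isClosed_sphere.measurableSet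
  rw [sphMeasure, hemb.integrable_map_iff]
  exact (hf.comp continuous_subtype_val).integrable_of_hasCompactSupport
    (HasCompactSupport.of_compactSpace _)

instance isFiniteMeasure_sphMeasure (n : ℕ) : IsFiniteMeasure (sphMeasure n) := by
  unfold sphMeasure
  infer_instance

theorem ae_mem_sphSet (n : ℕ) : ∀ᵐ x ∂(sphMeasure n), x ∈ sphSet n := by
  have hemb : MeasurableEmbedding (Subtype.val : Metric.sphere (0 : Eu n) 1 → Eu n) :=
    MeasurableEmbedding.subtype_coe Metric.isClosed_sphere.measurableSet
  rw [sphMeasure, hemb.ae_map_iff]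
  exact Eventually.of_forall fun x => x.2

theorem ae_norm_eq_one_confMeasure (n : ℕ) (w : Eu n → ℝ) :
    ∀ᵐ x ∂(confMeasure n w), ‖x‖ = 1 := by
  have h := (withDensity_absolutelyContinuous (sphMeasure n)
    (fun x => ENNReal.ofReal (w x ^ n))).ae_le (ae_mem_sphSet n)
  filter_upwards [h] with x hx
  simpa [sphSet] using hx

theorem gradS_inner {n : ℕ} (u x : Eu n) :
    gradS (fun y => (⟪u, y⟫ : ℝ)) x = u - (⟪u, x⟫ : ℝ) • x := by
  have h : HasGradientAt (fun y => (⟪u, y⟫ : ℝ)) u x := by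
    rw [hasGradientAt_iff_hasFDerivAt]
    exact ((InnerProductSpace.toDual ℝ (Eu n)) u).hasFDerivAt
  rw [gradS, h.gradient]

theorem norm_gradS_inner_sq_le {n : ℕ} (u : Eu n) {x : Eu n} (hx : x ∈ sphSet n) :
    ‖gradS (fun y => (⟪u, y⟫ : ℝ)) x‖ ^ 2 ≤ ‖u‖ ^ 2 := by
  have hx1 : ‖x‖ = 1 := by simpa [sphSet] using hx
  rw [gradS_inner, @norm_sub_sq_real, inner_smul_right, norm_smul, hx1, mul_one,
    Real.norm_eq_abs, sq_abs]
  nlinarith [sq_nonneg (⟪u, x⟫ : ℝ)]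

theorem integral_pow_eq_one {n : ℕ} {w : Eu n → ℝ} (hw : IsConformalFactor n w)
    (hvol : confMeasure n w Set.univ = 1) : ∫ x, w x ^ n ∂(sphMeasure n) = 1 := by
  have hnn : 0 ≤ᵐ[sphMeasure n] fun x => w x ^ n := by
    filter_upwards [ae_mem_sphSet n] with x hx
    exact pow_nonneg (hw.2 x hx).le n
  rw [confMeasure, withDensity_apply _ MeasurableSet.univ, Measure.restrict_univ] at hvol
  rw [integral_eq_lintegral_of_nonneg_ae hnn (hw.1.continuous.pow n).aestronglyMeasurable, hvol]
  rfl

theorem sigmaVol_pos {n : ℕ} {w : Eu n → ℝ} (hw : IsConformalFactor n w)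
    (hvol : confMeasure n w Set.univ = 1) : 0 < sigmaVol n := by
  refine ENNReal.toReal_pos (fun h => ?_) (measure_ne_top _ _)
  have h1 := integral_pow_eq_one hw hvol
  rw [Measure.measure_univ_eq_zero.mp h, integral_zero_measure] at h1
  exact zero_ne_one h1

/-- Hölder's inequality for a conformal factor of unit volume. -/
theorem integral_pow_sub_two_le {n : ℕ} (hn : 2 ≤ n) {w : Eu n → ℝ}
    (hw : IsConformalFactor n w) (hvol : confMeasure n w Set.univ = 1) :
    ∫ x, w x ^ (n - 2) ∂(sphMeasure n) ≤ sigmaVol n ^ ((2 : ℝ) / n) := by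
  have hσ := sigmaVol_pos hw hvol
  have hn2 : (2 : ℝ) ≤ n := by exact_mod_cast hn
  have hn0 : (0 : ℝ) < n := by linarith
  have hcast : ((n - 2 : ℕ) : ℝ) = n - 2 := by push_cast [Nat.cast_sub hn]; ring
  set σ := sigmaVol n with hσdef
  set α : ℝ := ((n : ℝ) - 2) / n with hα
  have hα0 : 0 ≤ α := div_nonneg (by linarith) hn0.le
  have hsum : α + 2 / n = 1 := by rw [hα]; field_simp; ring
  have hpt : ∀ᵐ x ∂(sphMeasure n),
      σ ^ α * w x ^ (n - 2) ≤ α * σ * w x ^ n + 2 / n := by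
    filter_upwards [ae_mem_sphSet n] with x hx
    have hwx := hw.2 x hx
    have h := Real.geom_mean_le_arith_mean2_weighted hα0 (by positivity : (0 : ℝ) ≤ 2 / n)
      (by positivity : 0 ≤ σ * w x ^ n) zero_le_one hsum
    rw [Real.one_rpow, mul_one, mul_one, Real.mul_rpow hσ.le (by positivity),
      ← Real.rpow_natCast_mul hwx.le, hα, mul_div_cancel₀ _ hn0.ne', ← hcast,
      Real.rpow_natCast] at h
    rw [hα, ← hcast]
    linarith
  have hint := integral_mono_ae
    ((integrable_sphMeasure n (hw.1.continuous.pow (n - 2))).const_mul (σ ^ α))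
    (((integrable_sphMeasure n (hw.1.continuous.pow n)).const_mul (α * σ)).add
      (integrable_const (2 / (n : ℝ)))) hpt
  simp only [Pi.add_apply] at hint
  rw [integral_const_mul, integral_add
    ((integrable_sphMeasure n (hw.1.continuous.pow n)).const_mul (α * σ)) (integrable_const _),
    integral_const_mul] at hint
  simp only [Pi.pow_apply] at hint
  rw [integral_pow_eq_one hw hvol, integral_const, smul_eq_mul] at hint
  have hreal : (sphMeasure n).real Set.univ = σ := rfl
  have hpow : σ ^ α * σ ^ ((2 : ℝ) / n) = σ := by
    rw [← Real.rpow_add hσ, hsum, Real.rpow_one]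
  refine le_of_mul_le_mul_left ?_ (Real.rpow_pos_of_pos hσ α)
  rw [hpow]
  rw [hreal] at hint
  calc _ ≤ α * σ * 1 + σ * (2 / n) := hint
    _ = σ * (α + 2 / n) := by ring
    _ = σ := by rw [hsum, mul_one]

theorem dirichlet_inner_le {n : ℕ} (hn : 2 ≤ n) {w : Eu n → ℝ}
    (hw : IsConformalFactor n w) (hvol : confMeasure n w Set.univ = 1) (u : Eu n) :
    dirichlet n w (fun y => (⟪u, y⟫ : ℝ)) ≤ ‖u‖ ^ 2 * sigmaVol n ^ ((2 : ℝ) / n) := by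
  refine le_trans ?_ (mul_le_mul_of_nonneg_left (integral_pow_sub_two_le hn hw hvol)
    (sq_nonneg ‖u‖))
  rw [dirichlet, ← integral_const_mul]
  have hwc := hw.1.continuous
  refine integral_mono_ae (integrable_sphMeasure n ?_) (integrable_sphMeasure n ?_) ?_
  · simp only [gradS_inner]
    fun_prop
  · fun_prop
  · filter_upwards [ae_mem_sphSet n] with x hx
    have h1 := norm_gradS_inner_sq_le u hx
    have h2 := pow_nonneg (hw.2 x hx).le (n - 2)
    nlinarith

theorem integrable_inner_sq {n : ℕ} {ν : Measure (Eu n)} [IsFiniteMeasure ν]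
    (hν : ∀ᵐ x ∂ν, ‖x‖ = 1) (s : Eu n) : Integrable (fun x => (⟪s, x⟫ : ℝ) ^ 2) ν := by
  refine Integrable.of_bound (by fun_prop) (‖s‖ ^ 2) ?_
  filter_upwards [hν] with x hx
  rw [norm_pow]
  have h := norm_inner_le_norm (𝕜 := ℝ) s x
  rw [hx, mul_one] at h
  exact pow_le_pow_left₀ (norm_nonneg _) h 2

theorem Qform_smul {n : ℕ} (ν : Measure (Eu n)) (c : ℝ) (s : Eu n) :
    Qform ν (c • s) = c ^ 2 * Qform ν s := by
  simp only [Qform, real_inner_smul_left, mul_pow, integral_const_mul]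

theorem Qform_le {n : ℕ} {ν : Measure (Eu n)} [IsProbabilityMeasure ν]
    (hν : ∀ᵐ x ∂ν, ‖x‖ = 1) (s : Eu n) : Qform ν s ≤ ‖s‖ ^ 2 := by
  have h : ∫ x, (⟪s, x⟫ : ℝ) ^ 2 ∂ν ≤ ∫ _, ‖s‖ ^ 2 ∂ν := by
    refine integral_mono_ae (integrable_inner_sq hν s) (integrable_const _) ?_
    filter_upwards [hν] with x hx
    have h := abs_real_inner_le_norm s x
    rw [hx, mul_one] at h
    exact sq_le_sq' (by linarith [neg_abs_le (⟪s, x⟫ : ℝ)]) ((le_abs_self _).trans h)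
  simpa [Qform] using h

theorem Qform_le_maxEig_of_norm_eq_one {n : ℕ} {ν : Measure (Eu n)} [IsProbabilityMeasure ν]
    (hν : ∀ᵐ x ∂ν, ‖x‖ = 1) {s : Eu n} (hs : ‖s‖ = 1) : Qform ν s ≤ maxEig n ν := by
  refine le_csSup ⟨1, ?_⟩ ⟨s, hs, rfl⟩
  rintro q ⟨t, ht, rfl⟩
  simpa [ht] using Qform_le hν t

theorem Qform_le_maxEig {n : ℕ} {ν : Measure (Eu n)} [IsProbabilityMeasure ν]
    (hν : ∀ᵐ x ∂ν, ‖x‖ = 1) (s : Eu n) : Qform ν s ≤ maxEig n ν * ‖s‖ ^ 2 := by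
  rcases eq_or_ne s 0 with rfl | hs
  · simp [Qform]
  · have hs' : ‖s‖ ≠ 0 := norm_ne_zero_iff.mpr hs
    have h1 : ‖(‖s‖⁻¹) • s‖ = 1 := by rw [norm_smul, norm_inv, norm_norm, inv_mul_cancel₀ hs']
    have h2 := Qform_le_maxEig_of_norm_eq_one hν h1
    have h3 : Qform ν s = ‖s‖ ^ 2 * Qform ν (‖s‖⁻¹ • s) := by
      rw [Qform_smul]; field_simp
    rw [h3, mul_comm]
    exact mul_le_mul_of_nonneg_right h2 (sq_nonneg _)

theorem one_le_mul_maxEig {n : ℕ} {ν : Measure (Eu n)} [IsProbabilityMeasure ν]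
    (hν : ∀ᵐ x ∂ν, ‖x‖ = 1) : 1 ≤ ((n : ℝ) + 1) * maxEig n ν := by
  have hsum : ∑ i : Fin (n + 1), Qform ν (EuclideanSpace.single i (1 : ℝ)) = 1 := by
    simp only [Qform]
    rw [← integral_finsetSum _ fun i _ => integrable_inner_sq hν _]
    have : ∫ x, ∑ i : Fin (n + 1), (⟪EuclideanSpace.single i (1 : ℝ), x⟫ : ℝ) ^ 2 ∂ν
        = ∫ _, (1 : ℝ) ∂ν := by
      refine integral_congr_ae ?_
      filter_upwards [hν] with x hx
      have h := EuclideanSpace.real_norm_sq_eq x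
      rw [hx, one_pow] at h
      simp [EuclideanSpace.inner_single_left, ← h]
    simpa using this
  refine hsum.symm.le.trans ?_
  refine (Finset.sum_le_sum fun i _ => Qform_le_maxEig_of_norm_eq_one hν
    (s := EuclideanSpace.single i (1 : ℝ)) (by simp)).trans_eq ?_
  simp

theorem Qform_add_add_Qform_sub {n : ℕ} {ν : Measure (Eu n)} [IsFiniteMeasure ν]
    (hν : ∀ᵐ x ∂ν, ‖x‖ = 1) (s t : Eu n) :
    Qform ν (s + t) + Qform ν (s - t) = 2 * Qform ν s + 2 * Qform ν t := by
  simp only [Qform]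
  rw [← integral_add (integrable_inner_sq hν _) (integrable_inner_sq hν _),
    ← integral_const_mul, ← integral_const_mul,
    ← integral_add ((integrable_inner_sq hν _).const_mul 2)
      ((integrable_inner_sq hν _).const_mul 2)]
  refine integral_congr_ae (Eventually.of_forall fun x => ?_)
  simp only [inner_add_left, inner_sub_left]
  ring

/-- The vectors on which `Q` attains its maximal eigenvalue are closed under addition. -/
theorem Qform_add_eq {n : ℕ} {ν : Measure (Eu n)} [IsProbabilityMeasure ν]
    (hν : ∀ᵐ x ∂ν, ‖x‖ = 1) {s t : Eu n} (hs : Qform ν s = maxEig n ν * ‖s‖ ^ 2)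
    (ht : Qform ν t = maxEig n ν * ‖t‖ ^ 2) :
    Qform ν (s + t) = maxEig n ν * ‖s + t‖ ^ 2 := by
  refine le_antisymm (Qform_le_maxEig hν _) ?_
  have h1 := Qform_le_maxEig hν (s - t)
  have h2 := Qform_add_add_Qform_sub hν s t
  have h3 := parallelogram_law_with_norm ℝ s t
  have h4 : maxEig n ν * ‖s + t‖ ^ 2 + maxEig n ν * ‖s - t‖ ^ 2 =
      2 * (maxEig n ν * ‖s‖ ^ 2) + 2 * (maxEig n ν * ‖t‖ ^ 2) := by
    linear_combination maxEig n ν * h3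
  linarith

theorem Qform_smul_eq {n : ℕ} {ν : Measure (Eu n)} {s : Eu n}
    (hs : Qform ν s = maxEig n ν * ‖s‖ ^ 2) (c : ℝ) :
    Qform ν (c • s) = maxEig n ν * ‖c • s‖ ^ 2 := by
  rw [Qform_smul, hs, norm_smul, mul_pow, Real.norm_eq_abs, sq_abs]
  ring

theorem add_one_le_mul_two_rpow {n : ℕ} (hn : n ≠ 0) :
    (n : ℝ) + 1 ≤ n * (2 : ℝ) ^ ((2 : ℝ) / n) := by
  have hn0 : (0 : ℝ) < n := by exact_mod_cast Nat.pos_of_ne_zero hn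
  have h1 : 1 / (n : ℝ) + 1 ≤ (2 : ℝ) ^ ((2 : ℝ) / n) := by
    refine (Real.add_one_le_exp _).trans ?_
    rw [Real.rpow_def_of_pos two_pos, Real.exp_le_exp, mul_div_assoc']
    gcongr
    linarith [Real.log_two_gt_d9]
  calc (n : ℝ) + 1 = n * (1 / n + 1) := by field_simp; ring
    _ ≤ _ := mul_le_mul_of_nonneg_left h1 hn0.le

theorem dirichlet_nonneg {n : ℕ} {w : Eu n → ℝ} (hw : IsConformalFactor n w)
    (V : Eu n → ℝ) : 0 ≤ dirichlet n w V := by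
  refine integral_nonneg_of_ae ?_
  filter_upwards [ae_mem_sphSet n] with x hx
  exact mul_nonneg (pow_nonneg (hw.2 x hx).le _) (sq_nonneg _)

theorem dirichlet_div_l2sq_le {n : ℕ} (hn : 2 ≤ n) {w : Eu n → ℝ}
    (hw : IsConformalFactor n w) (hvol : confMeasure n w Set.univ = 1) {u : Eu n} (hu : u ≠ 0)
    (hQ : Qform (confMeasure n w) u = maxEig n (confMeasure n w) * ‖u‖ ^ 2) :
    dirichlet n w (fun y => (⟪u, y⟫ : ℝ)) / l2sq n w (fun y => (⟪u, y⟫ : ℝ)) ≤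
      n * (2 * sigmaVol n) ^ ((2 : ℝ) / n) := by
  have : IsProbabilityMeasure (confMeasure n w) := ⟨hvol⟩
  have hM := one_le_mul_maxEig (ae_norm_eq_one_confMeasure n w)
  have hu2 : 0 < ‖u‖ ^ 2 := by positivity
  have hn1 : (0 : ℝ) < (n : ℝ) + 1 := by positivity
  set M := maxEig n (confMeasure n w)
  have hMpos : 0 < M := pos_of_mul_pos_right (one_pos.trans_le hM) hn1.le
  have hσ := Real.rpow_nonneg (sigmaVol_pos hw hvol).le ((2 : ℝ) / n)
  change _ / Qform (confMeasure n w) u ≤ _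
  rw [hQ, div_le_iff₀ (mul_pos hMpos hu2), Real.mul_rpow two_pos.le (sigmaVol_pos hw hvol).le]
  refine (dirichlet_inner_le hn hw hvol u).trans ?_
  have h1 : 1 ≤ n * (2 : ℝ) ^ ((2 : ℝ) / n) * M :=
    hM.trans (mul_le_mul_of_nonneg_right (add_one_le_mul_two_rpow (by omega)) hMpos.le)
  calc ‖u‖ ^ 2 * sigmaVol n ^ ((2 : ℝ) / n)
      ≤ (n * (2 : ℝ) ^ ((2 : ℝ) / n) * M) * (‖u‖ ^ 2 * sigmaVol n ^ ((2 : ℝ) / n)) :=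
        le_mul_of_one_le_left (mul_nonneg hu2.le hσ) h1
    _ = _ := by ring

/-- If `g` is conformal to `g₀`, of volume 1 and renormalized
(`∫ X_t dv_g = 0` for all `t`), and the measure `dv_g` is multiple, then
`λ₂(S^n,g) ≤ n (2σ_n)^{2/n}`. -/
theorem multiple_volume_measure_bound (n : ℕ) (hn : 2 ≤ n)
    (w : Eu n → ℝ) (hw : IsConformalFactor n w) (hvol : confMeasure n w Set.univ = 1)
    (hmean : ∀ t : Eu n, ∫ x, (⟪t, x⟫ : ℝ) ∂(confMeasure n w) = 0)
    (hmult : IsMultiple (confMeasure n w)) :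
    lambda2 n w ≤ (n : ℝ) * (2 * sigmaVol n) ^ ((2 : ℝ) / n) := by
  have : IsProbabilityMeasure (confMeasure n w) := ⟨hvol⟩
  have hν := ae_norm_eq_one_confMeasure n w
  obtain ⟨s, t, hs, ht, hli⟩ := hmult
  rw [LinearIndependent.pair_iff] at hli
  have hcomb : ∀ (a b : ℝ) (x : Eu n),
      a * (⟪s, x⟫ : ℝ) + b * (⟪t, x⟫ : ℝ) = ⟪a • s + b • t, x⟫ := fun a b x => by
    rw [inner_add_left, real_inner_smul_left, real_inner_smul_left]
  have hbdd : sSup { q : ℝ | ∃ a b : ℝ, ¬(a = 0 ∧ b = 0) ∧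
      q = dirichlet n w (fun x => a * (⟪s, x⟫ : ℝ) + b * (⟪t, x⟫ : ℝ)) /
          l2sq n w (fun x => a * (⟪s, x⟫ : ℝ) + b * (⟪t, x⟫ : ℝ)) } ≤
      n * (2 * sigmaVol n) ^ ((2 : ℝ) / n) := by
    refine Real.sSup_le ?_ ?_
    · rintro q ⟨a, b, hab, rfl⟩
      simp only [hcomb]
      exact dirichlet_div_l2sq_le hn hw hvol (fun h => hab (hli a b h))
        (Qform_add_eq hν (Qform_smul_eq hs a) (Qform_smul_eq ht b))
    · have := sigmaVol_pos hw hvol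
      positivity
  refine le_trans (csInf_le ?_ ⟨fun x => (⟪s, x⟫ : ℝ), fun x => (⟪t, x⟫ : ℝ),
    contDiff_const.inner ℝ contDiff_id, contDiff_const.inner ℝ contDiff_id,
    hmean s, hmean t, fun a b hab => hli a b ?_, rfl⟩) hbdd
  · refine ⟨0, ?_⟩
    rintro Λ ⟨V, W, -, -, -, -, -, rfl⟩
    refine Real.sSup_nonneg ?_
    rintro q ⟨a, b, -, rfl⟩
    exact div_nonneg (dirichlet_nonneg hw _) (integral_nonneg fun x => sq_nonneg _)
  · by_contra hne
    have hnorm : ‖a • s + b • t‖ ≠ 0 := norm_ne_zero_iff.mpr hne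
    have h := hab (‖a • s + b • t‖⁻¹ • (a • s + b • t)) (by
      simp only [sphSet, mem_sphere_iff_norm, sub_zero]
      rw [norm_smul, norm_inv, norm_norm, inv_mul_cancel₀ hnorm])
    rw [hcomb, real_inner_smul_right, real_inner_self_eq_norm_sq] at h
    exact mul_ne_zero (inv_ne_zero hnorm) (pow_ne_zero 2 hnorm) h

end
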